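/- arXiv:1203.0928 — 8 statements merged into one kernel-verified Lean document; each statement's English description precedes it below -/
import Mathlib

section
/- Let η, G, ν, ξ, a be positive real numbers. Suppose u : [0,1] → ℝ is twice continuously differentiable and τ, f : [0,1] → ℝ are continuously differentiable, with f(y) > 0 for all y ∈ [0,1], u(0) = 0, u(1) = a, and for all y ∈ [0,1]: 0 = η·u''(y) + τ'(y), 0 = G·u'(y) − f(y)·τ(y), and f(y) = (−1 + ξ|τ(y)|)/ν. Then for all y ∈ [0,1]: u(y) = a·y, τ(y) = (√(1 + 4νξGa) + 1)/(2ξ), and f(y) = (√(1 + 4νξGa) − 1)/(2ν). -/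
theorem tau_inj_aux (η k ξ s t : ℝ) (hη : 0 < η) (hk : 0 < k) (hξ : 0 < ξ)
    (hs : 0 < -1 + ξ * |s|) (ht : 0 < -1 + ξ * |t|)
    (h : η * ((-1 + ξ * |s|) * s) + k * s = η * ((-1 + ξ * |t|) * t) + k * t) : s = t := by
  have e1 : (η * (-1 + ξ * |s|) + k) * s = (η * (-1 + ξ * |t|) + k) * t := by linarith
  have p1 : 0 < η * (-1 + ξ * |s|) + k := by positivity
  have p2 : 0 < η * (-1 + ξ * |t|) + k := by positivity
  rcases le_or_gt 0 s with h1 | h1 <;> rcases le_or_gt 0 t with h2 | h2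
  · rw [abs_of_nonneg h1] at *
    rw [abs_of_nonneg h2] at *
    have p : 0 < η * ((-1 + ξ * s) + ξ * t) + k := by positivity
    have : (η * ((-1 + ξ * s) + ξ * t) + k) * (s - t) = 0 := by linarith
    rcases mul_eq_zero.1 this with h | h <;> linarith
  · have := mul_nonneg p1.le h1
    have := mul_neg_of_pos_of_neg p2 h2
    linarith
  · have := mul_nonneg p2.le h2
    have := mul_neg_of_pos_of_neg p1 h1
    linarith
  · rw [abs_of_neg h1] at *
    rw [abs_of_neg h2] at *
    have hp : 0 < ξ * -t := by nlinarith
    have p : 0 < η * ((-1 + ξ * -s) + ξ * -t) + k := by positivity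
    have : (η * ((-1 + ξ * -s) + ξ * -t) + k) * (s - t) = 0 := by linarith
    rcases mul_eq_zero.1 this with h | h <;> linarith

theorem const_aux (g g' : ℝ → ℝ)
    (hg : ∀ y ∈ Set.Icc (0 : ℝ) 1, HasDerivWithinAt g (g' y) (Set.Icc 0 1) y)
    (h0 : ∀ y ∈ Set.Icc (0 : ℝ) 1, g' y = 0) : ∀ y ∈ Set.Icc (0 : ℝ) 1, g y = g 0 := by
  apply constant_of_derivWithin_zero
  · exact fun y hy => (hg y hy).differentiableWithinAt
  · intro y hy
    have hy' := Set.Ico_subset_Icc_self hy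
    rw [(hg y hy').derivWithin (uniqueDiffOn_Icc one_pos y hy'), h0 y hy']

/-- Uniqueness of the stationary state with everywhere positive fluidity for the
aging-fluid system with non-homogeneous boundary conditions `u(0) = 0`, `u(1) = a > 0`. -/
theorem stmt_1 (η G ν ξ a : ℝ) (hη : 0 < η) (hG : 0 < G) (hν : 0 < ν) (hξ : 0 < ξ)
    (ha : 0 < a)
    (u u' u'' τ τ' f f' : ℝ → ℝ)
    (hu : ∀ y ∈ Set.Icc (0 : ℝ) 1, HasDerivWithinAt u (u' y) (Set.Icc 0 1) y)
    (hu' : ∀ y ∈ Set.Icc (0 : ℝ) 1, HasDerivWithinAt u' (u'' y) (Set.Icc 0 1) y)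
    (hu''c : ContinuousOn u'' (Set.Icc 0 1))
    (hτ : ∀ y ∈ Set.Icc (0 : ℝ) 1, HasDerivWithinAt τ (τ' y) (Set.Icc 0 1) y)
    (hτ'c : ContinuousOn τ' (Set.Icc 0 1))
    (hf : ∀ y ∈ Set.Icc (0 : ℝ) 1, HasDerivWithinAt f (f' y) (Set.Icc 0 1) y)
    (hf'c : ContinuousOn f' (Set.Icc 0 1))
    (hfpos : ∀ y ∈ Set.Icc (0 : ℝ) 1, 0 < f y)
    (hu0 : u 0 = 0) (hu1 : u 1 = a)
    (heq1 : ∀ y ∈ Set.Icc (0 : ℝ) 1, 0 = η * u'' y + τ' y)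
    (heq2 : ∀ y ∈ Set.Icc (0 : ℝ) 1, 0 = G * u' y - f y * τ y)
    (heq3 : ∀ y ∈ Set.Icc (0 : ℝ) 1, f y = (-1 + ξ * |τ y|) / ν) :
    ∀ y ∈ Set.Icc (0 : ℝ) 1,
      u y = a * y ∧
      τ y = (Real.sqrt (1 + 4 * ν * ξ * G * a) + 1) / (2 * ξ) ∧
      f y = (Real.sqrt (1 + 4 * ν * ξ * G * a) - 1) / (2 * ν) := by
  have m0 : (0:ℝ) ∈ Set.Icc (0:ℝ) 1 := by simp
  have m1 : (1:ℝ) ∈ Set.Icc (0:ℝ) 1 := by simp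
  have hp : ∀ y ∈ Set.Icc (0 : ℝ) 1, ν * f y = -1 + ξ * |τ y| := by
    intro y hy
    rw [heq3 y hy]
    field_simp
  have hK := const_aux (fun y => η * u' y + τ y) (fun y => η * u'' y + τ' y)
    (fun y hy => ((hu' y hy).const_mul η).add (hτ y hy)) (fun y hy => (heq1 y hy).symm)
  have hτc : ∀ y ∈ Set.Icc (0 : ℝ) 1, τ y = τ 0 := by
    intro y hy
    have q1 := mul_pos hν (hfpos y hy)
    have q0 := mul_pos hν (hfpos 0 m0)
    rw [hp y hy] at q1
    rw [hp 0 m0] at q0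
    refine tau_inj_aux η (ν * G) ξ _ _ hη (by positivity) hξ q1 q0 ?_
    rw [← hp y hy, ← hp 0 m0]
    have k := hK y hy
    linear_combination ν * G * k + η * ν * heq2 y hy - η * ν * heq2 0 m0
  have hfc : ∀ y ∈ Set.Icc (0 : ℝ) 1, f y = f 0 := by
    intro y hy
    rw [heq3 y hy, heq3 0 m0, hτc y hy]
  have hu'c : ∀ y ∈ Set.Icc (0 : ℝ) 1, u' y = u' 0 := by
    intro y hy
    have k := heq2 y hy
    rw [hfc y hy, hτc y hy] at k
    have k0 := heq2 0 m0
    exact mul_left_cancel₀ hG.ne' (by linarith)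
  have hU := const_aux (fun y => u y - u' 0 * y) (fun y => u' y - u' 0 * 1)
    (fun y hy => (hu y hy).sub ((hasDerivWithinAt_id y _).const_mul (u' 0)))
    (fun y hy => by rw [hu'c y hy]; ring)
  simp only [hu0, mul_zero, sub_zero] at hU
  have hua : u' 0 = a := by
    have := hU 1 m1
    rw [hu1] at this
    linarith
  have k0 := heq2 0 m0
  rw [hua] at k0
  have hf0 := hfpos 0 m0
  have hτ0 : 0 < τ 0 := by
    have : 0 < f 0 * τ 0 := by
      have := mul_pos hG ha
      linarith
    exact (mul_pos_iff_of_pos_left hf0).1 this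
  have hp0 := hp 0 m0
  rw [abs_of_pos hτ0] at hp0
  have hs : Real.sqrt (1 + 4 * ν * ξ * G * a) = 2 * ν * f 0 + 1 := by
    rw [Real.sqrt_eq_iff_mul_self_eq_of_pos (by positivity)]
    linear_combination (4 * ν * ξ) * k0 + 4 * ν * f 0 * hp0
  intro y hy
  rw [hτc y hy, hfc y hy, hs]
  refine ⟨?_, ?_, ?_⟩
  · have := hU y hy
    rw [hua] at this
    linarith
  · field_simp
    linarith
  · field_simp
    ring
end

section
/- Let η, G, ν, ξ be positive real numbers. Suppose u : [0,1] → ℝ is twice continuously differentiable and τ, f : [0,1] → ℝ are continuously differentiable, with f(y) ≥ 0 for all y ∈ [0,1], u(0) = 0, u(1) = 0, and for all y ∈ [0,1]: 0 = η·u''(y) + τ'(y), 0 = G·u'(y) − f(y)·τ(y), and 0 = (−1 + ξ|τ(y)|)·f(y)² − ν·f(y)³. Then u ≡ 0, f ≡ 0, and τ is constant on [0,1]. -/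
/-- Characterization of the steady states of the aging-fluid system with homogeneous
Dirichlet boundary conditions `u(0) = u(1) = 0` and non-negative fluidity:
`u ≡ 0`, `f ≡ 0` and `τ` constant. -/
theorem stmt_2 (η G ν ξ : ℝ) (hη : 0 < η) (hG : 0 < G) (hν : 0 < ν) (hξ : 0 < ξ)
    (u u' u'' τ τ' f f' : ℝ → ℝ)
    (hu : ∀ y ∈ Set.Icc (0 : ℝ) 1, HasDerivWithinAt u (u' y) (Set.Icc 0 1) y)
    (hu' : ∀ y ∈ Set.Icc (0 : ℝ) 1, HasDerivWithinAt u' (u'' y) (Set.Icc 0 1) y)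
    (hu''c : ContinuousOn u'' (Set.Icc 0 1))
    (hτ : ∀ y ∈ Set.Icc (0 : ℝ) 1, HasDerivWithinAt τ (τ' y) (Set.Icc 0 1) y)
    (hτ'c : ContinuousOn τ' (Set.Icc 0 1))
    (hf : ∀ y ∈ Set.Icc (0 : ℝ) 1, HasDerivWithinAt f (f' y) (Set.Icc 0 1) y)
    (hf'c : ContinuousOn f' (Set.Icc 0 1))
    (hfnn : ∀ y ∈ Set.Icc (0 : ℝ) 1, 0 ≤ f y)
    (hu0 : u 0 = 0) (hu1 : u 1 = 0)
    (heq1 : ∀ y ∈ Set.Icc (0 : ℝ) 1, 0 = η * u'' y + τ' y)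
    (heq2 : ∀ y ∈ Set.Icc (0 : ℝ) 1, 0 = G * u' y - f y * τ y)
    (heq3 : ∀ y ∈ Set.Icc (0 : ℝ) 1,
      0 = (-1 + ξ * |τ y|) * (f y) ^ 2 - ν * (f y) ^ 3) :
    ∃ c : ℝ, ∀ y ∈ Set.Icc (0 : ℝ) 1, u y = 0 ∧ f y = 0 ∧ τ y = c := by
  have h0 : (0 : ℝ) ∈ Set.Icc (0 : ℝ) 1 := by simp
  have h1 : (1 : ℝ) ∈ Set.Icc (0 : ℝ) 1 := by simp
  have key : ∀ g g' : ℝ → ℝ,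
      (∀ y ∈ Set.Icc (0 : ℝ) 1, HasDerivWithinAt g (g' y) (Set.Icc 0 1) y) →
      (∀ y ∈ Set.Icc (0 : ℝ) 1, 0 ≤ g' y) → MonotoneOn g (Set.Icc 0 1) := by
    intro g g' hg hn
    refine monotoneOn_of_hasDerivWithinAt_nonneg (f' := g') (convex_Icc 0 1)
      (fun y hy => (hg y hy).continuousWithinAt) ?_ ?_
    · intro y hy
      exact (hg y (interior_subset hy)).mono interior_subset
    · intro y hy
      exact hn y (interior_subset hy)
  have keyc : ∀ g : ℝ → ℝ,
      (∀ y ∈ Set.Icc (0 : ℝ) 1, HasDerivWithinAt g 0 (Set.Icc 0 1) y) →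
      ∀ y ∈ Set.Icc (0 : ℝ) 1, g y = g 0 := by
    intro g hg y hy
    have a := key g (fun _ => 0) hg (fun _ _ => le_rfl) h0 hy hy.1
    have b := key (fun y => - g y) (fun _ => 0)
      (fun y hy => by simpa using (hg y hy).fun_neg) (fun _ _ => le_rfl) h0 hy hy.1
    simp only at b
    linarith
  obtain ⟨c, hc⟩ : ∃ c, ∀ y ∈ Set.Icc (0 : ℝ) 1, η * u' y + τ y = c := by
    refine ⟨η * u' 0 + τ 0, keyc (fun y => η * u' y + τ y) ?_⟩
    intro y hy
    have := ((hu' y hy).const_mul η).fun_add (hτ y hy)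
    rwa [← heq1 y hy] at this
  have hfac : ∀ y ∈ Set.Icc (0 : ℝ) 1, G * c = (η * f y + G) * τ y := by
    intro y hy
    linear_combination (-G) * hc y hy - η * heq2 y hy
  have hu'0 : ∀ y ∈ Set.Icc (0 : ℝ) 1, u' y = 0 := by
    by_cases hc0 : c = 0
    · intro y hy
      have h := hfac y hy
      have hp : 0 < η * f y + G := by
        have := mul_nonneg hη.le (hfnn y hy)
        linarith
      have ht : τ y = 0 := by
        rw [hc0, mul_zero] at h
        rcases mul_eq_zero.mp h.symm with h | h
        · exact absurd h hp.ne'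
        · exact h
      have h2 := heq2 y hy
      rw [ht] at h2
      have : G * u' y = 0 := by linarith
      exact (mul_eq_zero.mp this).resolve_left hG.ne'
    · have hm := key (fun y => c * u y) (fun y => c * u' y)
        (fun y hy => (hu y hy).const_mul c) (by
          intro y hy
          have e : G ^ 2 * (c * u' y) = (η * f y + G) * f y * τ y ^ 2 := by
            linear_combination (G * u' y) * hfac y hy - (η * f y + G) * τ y * heq2 y hy
          have hfy := hfnn y hy
          have : 0 ≤ G ^ 2 * (c * u' y) := by rw [e]; positivity
          exact nonneg_of_mul_nonneg_right this (by positivity))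
      have hz : ∀ y ∈ Set.Icc (0 : ℝ) 1, u y = 0 := by
        intro y hy
        have a := hm h0 hy hy.1
        have b := hm hy h1 hy.2
        simp only [hu0, hu1, mul_zero] at a b
        exact (mul_eq_zero.mp (le_antisymm b a)).resolve_left hc0
      intro y hy
      have hd : HasDerivWithinAt u 0 (Set.Icc 0 1) y :=
        (hasDerivWithinAt_const y (Set.Icc (0 : ℝ) 1) (0 : ℝ)).congr hz (hz y hy)
      exact (uniqueDiffOn_Icc_zero_one y hy).eq_deriv _ (hu y hy) hd
  refine ⟨c, fun y hy => ⟨?_, ?_, ?_⟩⟩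
  · rw [keyc u (fun y hy => by simpa [hu'0 y hy] using hu y hy) y hy, hu0]
  · have h2 := heq2 y hy
    rw [hu'0 y hy] at h2
    have h3 : f y * τ y = 0 := by linarith
    rcases mul_eq_zero.mp h3 with h | h
    · exact h
    · have h4 := heq3 y hy
      rw [h, abs_zero] at h4
      have hfy := hfnn y hy
      have : 0 ≤ ν * f y ^ 3 := by positivity
      have : f y ^ 2 = 0 := by nlinarith [sq_nonneg (f y)]
      exact pow_eq_zero_iff (two_ne_zero) |>.mp this
  · have := hc y hy
    rw [hu'0 y hy] at this
    linarith
end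

section
/- Let ξ, ν > 0, let τ : [0,∞) → ℝ be continuous, and let f : [0,∞) → ℝ be differentiable with f'(t) = (−1 + ξ|τ(t)|)·f(t)² − ν·f(t)³ for all t ≥ 0. Then: (i) if f(0) > 0, then f(t) > 0 for all t ≥ 0; (ii) if f(0) = 0, then f(t) = 0 for all t ≥ 0. -/
/-- The sign (zero or strictly positive) of the fluidity is preserved in time for the
scalar ODE `∂f/∂t = (−1+ξ|τ|)f² − νf³`. -/
theorem stmt_3 (ξ ν : ℝ) (hξ : 0 < ξ) (hν : 0 < ν)
    (τ f : ℝ → ℝ)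
    (hτ : ContinuousOn τ (Set.Ici (0 : ℝ)))
    (hf : ∀ t ∈ Set.Ici (0 : ℝ),
      HasDerivWithinAt f ((-1 + ξ * |τ t|) * (f t) ^ 2 - ν * (f t) ^ 3)
        (Set.Ici 0) t) :
    (0 < f 0 → ∀ t ∈ Set.Ici (0 : ℝ), 0 < f t) ∧
    (f 0 = 0 → ∀ t ∈ Set.Ici (0 : ℝ), f t = 0) := by
  have hfc : ContinuousOn f (Set.Ici 0) := fun t ht => (hf t ht).continuousWithinAt
  have hsub : ∀ T : ℝ, Set.Icc 0 T ⊆ Set.Ici (0 : ℝ) := fun T x hx => hx.1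
  have hK : ∀ T : ℝ, ∃ K : ℝ, ∀ t ∈ Set.Icc 0 T,
      ‖(-1 + ξ * |τ t|) * (f t) ^ 2 - ν * (f t) ^ 3‖ ≤ K * ‖f t‖ := by
    intro T
    have hc : ContinuousOn (fun t => (-1 + ξ * |τ t|) * f t - ν * (f t) ^ 2)
        (Set.Icc 0 T) := by
      have h1 := hfc.mono (hsub T)
      have h2 := hτ.mono (hsub T)
      have h3 : ContinuousOn (fun t => |τ t|) (Set.Icc 0 T) := h2.abs
      fun_prop
    obtain ⟨K, hK⟩ := isCompact_Icc.exists_bound_of_continuousOn hc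
    refine ⟨K, fun t ht => ?_⟩
    have : (-1 + ξ * |τ t|) * (f t) ^ 2 - ν * (f t) ^ 3
        = ((-1 + ξ * |τ t|) * f t - ν * (f t) ^ 2) * f t := by ring
    rw [this, norm_mul]
    exact mul_le_mul_of_nonneg_right (hK t ht) (norm_nonneg _)
  constructor
  · intro h0 t ht
    by_contra hneg
    push Not at hneg
    obtain ⟨s, hs, hs0⟩ := intermediate_value_Icc' (Set.mem_Ici.mp ht)
      (hfc.mono (hsub t)) ⟨hneg, h0.le⟩
    obtain ⟨K, hK⟩ := hK s
    have key := norm_le_gronwallBound_of_norm_deriv_right_le (f := fun x => f (s - x))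
      (f' := fun x => -((-1 + ξ * |τ (s - x)|) * (f (s - x)) ^ 2 - ν * (f (s - x)) ^ 3))
      (δ := 0) (K := K) (ε := 0) (a := 0) (b := s)
      (by
        refine hfc.comp (by fun_prop) ?_
        intro x hx
        simpa using hx.2)
      (by
        intro x hx
        have hpos : 0 < s - x := by linarith [hx.2]
        have h1 := (hf (s - x) hpos.le).hasDerivAt (Ici_mem_nhds hpos)
        exact (h1.comp_const_sub s x).hasDerivWithinAt)
      (by simp [hs0])
      (by
        intro x hx
        rw [norm_neg, add_zero]
        exact hK (s - x) ⟨by linarith [hx.2], by linarith [hx.1]⟩)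
      s ⟨hs.1, le_rfl⟩
    simp [gronwallBound_ε0] at key
    linarith
  · intro h0 t ht
    obtain ⟨K, hK⟩ := hK t
    have key := norm_le_gronwallBound_of_norm_deriv_right_le (f := f)
      (δ := 0) (K := K) (ε := 0) (a := 0) (b := t) (hfc.mono (hsub t))
      (fun x hx => (hf x hx.1).mono (Set.Ici_subset_Ici.mpr hx.1))
      (by simp [h0])
      (fun x hx => by
        rw [add_zero]
        exact hK x ⟨hx.1, hx.2.le⟩)
      t ⟨ht, le_rfl⟩
    simpa [gronwallBound_ε0] using key
end

section
/- Let ξ, ν > 0 and M ≥ 0. Let τ : [0,T] → ℝ satisfy |τ(t)| ≤ M for all t ∈ [0,T], and let f : [0,T] → ℝ be differentiable with f(t) ≥ 0 and f'(t) = (−1 + ξ|τ(t)|)·f(t)² − ν·f(t)³ for all t ∈ [0,T]. Then for all t ∈ [0,T], f(t) ≤ f(0) + (ξ/ν)·M. -/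
/-- Pointwise L∞-bound on the fluidity: if `|τ| ≤ M` on `[0,T]` and `f ≥ 0` solves
`f' = (−1+ξ|τ|)f² − νf³`, then `f(t) ≤ f(0) + (ξ/ν)·M` on `[0,T]`. -/
theorem stmt_4 (ξ ν M T : ℝ) (hξ : 0 < ξ) (hν : 0 < ν) (hM : 0 ≤ M) (hT : 0 < T)
    (τ f : ℝ → ℝ)
    (hτ : ∀ t ∈ Set.Icc (0 : ℝ) T, |τ t| ≤ M)
    (hfnn : ∀ t ∈ Set.Icc (0 : ℝ) T, 0 ≤ f t)
    (hf : ∀ t ∈ Set.Icc (0 : ℝ) T,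
      HasDerivWithinAt f ((-1 + ξ * |τ t|) * (f t) ^ 2 - ν * (f t) ^ 3)
        (Set.Icc 0 T) t) :
    ∀ t ∈ Set.Icc (0 : ℝ) T, f t ≤ f 0 + (ξ / ν) * M := by
  intro t ht
  refine le_of_forall_pos_le_add fun ε hε => ?_
  have h0 : 0 ≤ f 0 := hfnn 0 ⟨le_rfl, hT.le⟩
  have hc : 0 ≤ ξ / ν * M := by positivity
  refine image_le_of_deriv_right_lt_deriv_boundary
    (f' := fun t => (-1 + ξ * |τ t|) * (f t) ^ 2 - ν * (f t) ^ 3)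
    (B := fun _ => f 0 + ξ / ν * M + ε) (B' := fun _ => 0)
    (fun x hx => (hf x hx).continuousWithinAt) ?_ (by linarith)
    (fun x => hasDerivAt_const x _) ?_ ht
  · intro x hx
    refine (hf x ⟨hx.1, hx.2.le⟩).mono_of_mem_nhdsWithin ?_
    exact mem_nhdsWithin.2 ⟨Set.Iio T, isOpen_Iio, hx.2,
      fun y hy => ⟨hx.1.trans hy.2, le_of_lt hy.1⟩⟩
  · intro x hx hfx
    have hτx : ξ * |τ x| ≤ ξ * M :=
      mul_le_mul_of_nonneg_left (hτ x ⟨hx.1, hx.2.le⟩) hξ.le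
    have hpos : 0 < f x := by
      have : f x = f 0 + ξ / ν * M + ε := hfx
      linarith
    have hν' : ξ * M ≤ ν * f x := by
      have h1 : ξ / ν * M ≤ f x := by
        have : f x = f 0 + ξ / ν * M + ε := hfx
        linarith
      have h2 := mul_le_mul_of_nonneg_left h1 hν.le
      have h3 : ν * (ξ / ν * M) = ξ * M := by field_simp
      linarith
    have h4 : (-1 + ξ * |τ x| - ν * f x) * (f x) ^ 2 < 0 :=
      mul_neg_of_neg_of_pos (by linarith) (by positivity)
    change (-1 + ξ * |τ x|) * (f x) ^ 2 - ν * (f x) ^ 3 < 0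
    linarith [h4, show (-1 + ξ * |τ x| - ν * f x) * (f x) ^ 2
      = (-1 + ξ * |τ x|) * (f x) ^ 2 - ν * (f x) ^ 3 by ring]
end

section
/- Let ξ, ν > 0, t₀ ≥ 0, and M_τ > 1/ξ; set M_f = 2(−1 + ξM_τ)/ν. Let τ : [t₀,∞) → ℝ satisfy τ(t) ≤ M_τ for all t ≥ t₀, and let f : [t₀,∞) → ℝ be differentiable with f(t) > 0 and f'(t) = (−1 + ξτ(t))·f(t)² − ν·f(t)³ for all t ≥ t₀. Then for all t ≥ t₀, f(t) ≤ max(f(t₀), M_f). -/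
/-- Upper bound on the fluidity from an upper bound on the stress: if `τ ≤ M_τ` and
`f > 0` solves `f' = (−1+ξτ)f² − νf³` on `[t₀,∞)`, then `f(t) ≤ max(f(t₀), M_f)` with
`M_f = 2(−1+ξM_τ)/ν`. -/
theorem stmt_7 (ξ ν t₀ Mτ : ℝ) (hξ : 0 < ξ) (hν : 0 < ν) (ht₀ : 0 ≤ t₀)
    (hMτ : 1 / ξ < Mτ)
    (Mf : ℝ) (hMf : Mf = 2 * (-1 + ξ * Mτ) / ν)
    (τ f : ℝ → ℝ)
    (hτ : ∀ t ∈ Set.Ici t₀, τ t ≤ Mτ)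
    (hfpos : ∀ t ∈ Set.Ici t₀, 0 < f t)
    (hf : ∀ t ∈ Set.Ici t₀,
      HasDerivWithinAt f ((-1 + ξ * τ t) * (f t) ^ 2 - ν * (f t) ^ 3)
        (Set.Ici t₀) t) :
    ∀ t ∈ Set.Ici t₀, f t ≤ max (f t₀) Mf := by
  intro t ht
  have hA : 0 < -1 + ξ * Mτ := by
    rw [div_lt_iff₀ hξ] at hMτ
    linarith
  have hνM : ν * Mf = 2 * (-1 + ξ * Mτ) := by
    rw [hMf]
    field_simp
  refine image_le_of_deriv_right_lt_deriv_boundary' (a := t₀) (b := t) (f := f)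
    (f' := fun x => (-1 + ξ * τ x) * (f x) ^ 2 - ν * (f x) ^ 3)
    (B := fun _ => max (f t₀) Mf) (B' := fun _ => 0)
    ?_ ?_ (le_max_left _ _) continuousOn_const
    (fun x _ => hasDerivWithinAt_const _ _ _) ?_ ⟨ht, le_rfl⟩
  · intro x hx
    exact ((hf x hx.1).continuousWithinAt).mono Set.Icc_subset_Ici_self
  · intro x hx
    exact (hf x hx.1).mono (Set.Ici_subset_Ici.2 hx.1)
  · intro x hx hxe
    have hM : Mf ≤ f x := by
      rw [hxe]
      exact le_max_right _ _
    have h1 : ξ * τ x ≤ ξ * Mτ := mul_le_mul_of_nonneg_left (hτ x hx.1) hξ.le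
    have h2 : ν * Mf ≤ ν * f x := mul_le_mul_of_nonneg_left hM hν.le
    have h3 : 0 < (f x) ^ 2 := pow_pos (hfpos x hx.1) 2
    have h4 : -1 + ξ * τ x - ν * f x < 0 := by linarith
    have h5 := mul_neg_of_neg_of_pos h4 h3
    show (-1 + ξ * τ x) * (f x) ^ 2 - ν * (f x) ^ 3 < 0
    linarith [h5, show (-1 + ξ * τ x - ν * f x) * (f x) ^ 2
      = (-1 + ξ * τ x) * (f x) ^ 2 - ν * (f x) ^ 3 by ring]
end

section
/- Let G, a, ν, ξ > 0, set τ∞ = (√(1 + 4νξGa) + 1)/(2ξ) and σ = min(3Ga/(Gaν + 4τ∞), (√(1 + 4νξGa) − 1)/(3ν)). Then for all real numbers f and τ with 0 ≤ f ≤ σ and 0 ≤ τ ≤ τ∞, one has −3Ga + Gaνf − ξfτ² + 4fτ ≤ 0. -/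
/-- Key algebraic inequality in region A₁: for `0 ≤ f ≤ σ` and `0 ≤ τ ≤ τ∞`,
`−3Ga + Gaνf − ξfτ² + 4fτ ≤ 0`. -/
theorem stmt_8 (G a ν ξ : ℝ) (hG : 0 < G) (ha : 0 < a) (hν : 0 < ν) (hξ : 0 < ξ)
    (τinf σ : ℝ)
    (hτinf : τinf = (Real.sqrt (1 + 4 * ν * ξ * G * a) + 1) / (2 * ξ))
    (hσ : σ = min (3 * G * a / (G * a * ν + 4 * τinf))
      ((Real.sqrt (1 + 4 * ν * ξ * G * a) - 1) / (3 * ν))) :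
    ∀ f τ : ℝ, 0 ≤ f → f ≤ σ → 0 ≤ τ → τ ≤ τinf →
      -(3 * G * a) + G * a * ν * f - ξ * f * τ ^ 2 + 4 * f * τ ≤ 0 := by
  intro f τ hf hfσ hτ hττ
  have hpos : 0 < τinf := by
    rw [hτinf]
    positivity
  have hD : 0 < G * a * ν + 4 * τinf := by positivity
  have h1 : f ≤ 3 * G * a / (G * a * ν + 4 * τinf) := by
    rw [hσ] at hfσ
    exact hfσ.trans (min_le_left _ _)
  have h2 : f * (G * a * ν + 4 * τinf) ≤ 3 * G * a := (le_div_iff₀ hD).mp h1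
  have h3 : f * τ ≤ f * τinf := mul_le_mul_of_nonneg_left hττ hf
  have h4 : 0 ≤ ξ * f * τ ^ 2 := by positivity
  linarith
end

section
/- Let λ, G, a > 0. Let f : [0,∞) → ℝ satisfy f(t) > 0 for all t ≥ 0, and let τ : [0,∞) → ℝ be differentiable with λ·τ'(t) = −f(t)·τ(t) + G·a for all t ≥ 0. Suppose moreover that τ is bounded on [0,∞). Then there exists T₀ ≥ 0 such that τ(t) > 0 for all t > T₀. -/
/-- The stress becomes positive after some finite time: if `f > 0` and the bounded
stress satisfies `λ·τ' = −f·τ + G·a`, then `τ(t) > 0` for all large `t`. -/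
theorem stmt_9 (lam G a : ℝ) (hlam : 0 < lam) (hG : 0 < G) (ha : 0 < a)
    (f τ τ' : ℝ → ℝ)
    (hfpos : ∀ t ∈ Set.Ici (0 : ℝ), 0 < f t)
    (hτ : ∀ t ∈ Set.Ici (0 : ℝ), HasDerivWithinAt τ (τ' t) (Set.Ici 0) t)
    (heq : ∀ t ∈ Set.Ici (0 : ℝ), lam * τ' t = -f t * τ t + G * a)
    (hbdd : ∃ M : ℝ, ∀ t ∈ Set.Ici (0 : ℝ), |τ t| ≤ M) :
    ∃ T₀ : ℝ, 0 ≤ T₀ ∧ ∀ t > T₀, 0 < τ t := by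
  obtain ⟨M, hM⟩ := hbdd
  have hM0 : 0 ≤ M := (abs_nonneg _).trans (hM 0 (Set.mem_Ici.2 le_rfl))
  obtain ⟨c, hc⟩ : ∃ c, c = G * a / lam := ⟨_, rfl⟩
  have hGa : 0 < G * a := mul_pos hG ha
  have hcpos : 0 < c := by rw [hc]; exact div_pos hGa hlam
  have hclam : lam * c = G * a := by rw [hc]; field_simp
  have key : ∀ t, 0 ≤ t → τ t ≤ 0 → c ≤ τ' t := by
    intro t ht h
    have h1 := heq t ht
    have h2 : 0 ≤ f t * (-τ t) := mul_nonneg (hfpos t ht).le (by linarith)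
    have h3 : lam * c ≤ lam * τ' t := by rw [h1, hclam]; linarith
    exact le_of_mul_le_mul_left h3 hlam
  have hcont : ∀ x y, 0 ≤ x → ContinuousOn (fun t => -τ t) (Set.Icc x y) := by
    intro x y hx t ht
    have h0 : (0 : ℝ) ≤ t := hx.trans ht.1
    exact ((hτ t h0).continuousWithinAt.mono (fun s hs => hx.trans hs.1)).neg
  have hder : ∀ x y, 0 ≤ x → ∀ t ∈ Set.Ico x y,
      HasDerivWithinAt (fun t => -τ t) (-τ' t) (Set.Ici t) t := by
    intro x y hx t ht
    have h0 : (0 : ℝ) ≤ t := hx.trans ht.1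
    exact ((hτ t h0).mono (Set.Ici_subset_Ici.2 h0)).fun_neg
  have hT0 : 0 ≤ 2 * M / c := by positivity
  obtain ⟨T, hT⟩ : ∃ T, T = 2 * M / c := ⟨_, rfl⟩
  rw [← hT] at hT0
  have hTc : c * T = 2 * M := by rw [hT]; field_simp
  have step1 : 0 ≤ τ T := by
    have hB : ∀ x : ℝ, HasDerivAt (fun t => M - c / 2 * t) (-(c / 2)) x := by
      intro x
      simpa using ((hasDerivAt_id x).const_mul (c / 2)).const_sub M
    have := image_le_of_deriv_right_lt_deriv_boundary (hcont 0 T le_rfl) (hder 0 T le_rfl)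
      (B := fun t => M - c / 2 * t) (B' := fun _ => -(c / 2))
      (by have := (abs_le.1 (hM 0 (Set.mem_Ici.2 le_rfl))).1
          simp only [mul_zero, sub_zero]; linarith) hB
      (by
        intro x hx h
        have h1 : c * x ≤ c * T := mul_le_mul_of_nonneg_left hx.2.le hcpos.le
        have h2 := key x hx.1 (by linarith)
        linarith) (Set.right_mem_Icc.2 hT0)
    linarith
  have step2 : ∀ t, T ≤ t → 0 ≤ τ t := by
    intro t ht
    have := image_le_of_deriv_right_lt_deriv_boundary (hcont T t hT0) (hder T t hT0)
      (B := fun _ => (0 : ℝ)) (B' := fun _ => 0)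
      (by simpa using step1) (fun x => hasDerivAt_const x 0)
      (by
        intro x hx h
        have h2 := key x (hT0.trans hx.1) (by linarith)
        linarith) (Set.right_mem_Icc.2 ht)
    linarith
  refine ⟨T, hT0, fun t ht => lt_of_le_of_ne (step2 t ht.le) fun h0 => ?_⟩
  have htpos : 0 < t := hT0.trans_lt ht
  have hmin : IsLocalMin τ t := by
    filter_upwards [Ioi_mem_nhds ht] with s hs
    rw [← h0]
    exact step2 s (le_of_lt hs)
  have hz := hmin.hasDerivAt_eq_zero ((hτ t htpos.le).hasDerivAt (Ici_mem_nhds htpos))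
  have := key t htpos.le h0.symm.le
  linarith
end

section
/- Let λ, G, a, ξ, ν > 0, and let τ, f : [0,∞) → ℝ be differentiable functions satisfying λ·τ'(t) = −f(t)·τ(t) + G·a and f'(t) = (−1 + ξ|τ(t)|)·f(t)² − ν·f(t)³ for all t ≥ 0, with f(0) > 0. Then the solution remains bounded: there exists M ≥ 0 such that |τ(t)| + |f(t)| ≤ M for all t ≥ 0. -/
theorem barrier_aux (h h' : ℝ → ℝ) (C : ℝ)
    (hd : ∀ t ∈ Set.Ici (0 : ℝ), HasDerivWithinAt h (h' t) (Set.Ici 0) t)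
    (h0 : h 0 ≤ C) (hneg : ∀ t, 0 ≤ t → C < h t → h' t ≤ 0) :
    ∀ t, 0 ≤ t → h t ≤ C := by
  intro t ht
  by_contra hc
  push Not at hc
  have hcont : ContinuousOn h (Set.Icc 0 t) := fun x hx =>
    ((hd x hx.1).continuousWithinAt).mono Set.Icc_subset_Ici_self
  have hcl : IsClosed (Set.Icc 0 t ∩ h ⁻¹' Set.Iic C) :=
    hcont.preimage_isClosed_of_isClosed isClosed_Icc isClosed_Iic
  have hcomp : IsCompact (Set.Icc 0 t ∩ h ⁻¹' Set.Iic C) :=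
    isCompact_Icc.of_isClosed_subset hcl Set.inter_subset_left
  obtain ⟨s, ⟨⟨hs0, hst⟩, hsC⟩, hmax⟩ := hcomp.exists_isGreatest ⟨0, ⟨le_refl _, ht⟩, h0⟩
  have hanti : AntitoneOn h (Set.Icc s t) := by
    apply antitoneOn_of_hasDerivWithinAt_nonpos (f' := h') (convex_Icc s t)
    · exact hcont.mono (Set.Icc_subset_Icc_left hs0)
    · intro x hx
      rw [interior_Icc] at hx ⊢
      exact (hd x (hs0.trans hx.1.le)).mono (fun y hy => hs0.trans hy.1.le)
    · intro x hx
      rw [interior_Icc] at hx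
      apply hneg x (hs0.trans hx.1.le)
      by_contra hx2
      push Not at hx2
      have := hmax ⟨⟨hs0.trans hx.1.le, hx.2.le⟩, hx2⟩
      linarith [hx.1]
  have := hanti ⟨le_refl _, hst⟩ ⟨hst, le_refl _⟩ hst
  have h2 : h s ≤ C := hsC
  linarith

theorem pos_aux (f p : ℝ → ℝ) (hp : ContinuousOn p (Set.Ici 0))
    (hd : ∀ t ∈ Set.Ici (0 : ℝ), HasDerivWithinAt f (f t * p t) (Set.Ici 0) t)
    (h0 : 0 < f 0) : ∀ t, 0 ≤ t → 0 < f t := by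
  intro t ht
  by_contra hc
  push Not at hc
  have hcont : ContinuousOn f (Set.Icc 0 t) := fun x hx =>
    ((hd x hx.1).continuousWithinAt).mono Set.Icc_subset_Ici_self
  have hcl : IsClosed (Set.Icc 0 t ∩ f ⁻¹' Set.Iic 0) :=
    hcont.preimage_isClosed_of_isClosed isClosed_Icc isClosed_Iic
  have hcomp : IsCompact (Set.Icc 0 t ∩ f ⁻¹' Set.Iic 0) :=
    isCompact_Icc.of_isClosed_subset hcl Set.inter_subset_left
  obtain ⟨s, ⟨⟨hs0, hst⟩, hsC⟩, hmin⟩ := hcomp.exists_isLeast ⟨t, ⟨ht, le_refl _⟩, hc⟩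
  obtain ⟨K, hK⟩ := isCompact_Icc.exists_bound_of_continuousOn
    (hp.mono (Set.Icc_subset_Ici_self : Set.Icc 0 s ⊆ Set.Ici 0))
  have hE : ∀ x, HasDerivAt (fun x => Real.exp (K * x)) (Real.exp (K * x) * K) x := by
    intro x
    simpa using ((hasDerivAt_id x).const_mul K).exp
  have hmono : MonotoneOn (fun x => f x * Real.exp (K * x)) (Set.Icc 0 s) := by
    apply monotoneOn_of_hasDerivWithinAt_nonneg
      (f' := fun x => f x * p x * Real.exp (K * x) + f x * (Real.exp (K * x) * K)) (convex_Icc 0 s)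
    · exact (hcont.mono (Set.Icc_subset_Icc_right hst)).mul (by fun_prop)
    · intro x hx
      rw [interior_Icc] at hx ⊢
      exact ((hd x hx.1.le).mono (fun y hy => hy.1.le)).mul (hE x).hasDerivWithinAt
    · intro x hx
      rw [interior_Icc] at hx
      have h1 : 0 < f x := by
        by_contra hx2
        push Not at hx2
        have := hmin ⟨⟨hx.1.le, hx.2.le.trans hst⟩, hx2⟩
        linarith [hx.2]
      have h2 := (abs_le.1 (hK x ⟨hx.1.le, hx.2.le⟩)).1
      have : 0 ≤ f x * Real.exp (K * x) * (p x + K) :=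
        mul_nonneg (by positivity) (by linarith)
      linarith
  have h3 := hmono ⟨le_refl _, hs0⟩ ⟨hs0, le_refl _⟩ hs0
  have h4 : f s ≤ 0 := hsC
  simp only [mul_zero, Real.exp_zero, mul_one] at h3
  have := mul_nonpos_of_nonpos_of_nonneg h4 (Real.exp_pos (K * s)).le
  linarith

/-- Boundedness of solutions of the aging-fluid ODE system
`λτ' = −fτ + Ga`, `f' = (−1+ξ|τ|)f² − νf³` with positive initial fluidity. -/
theorem stmt_10 (lam G a ξ ν : ℝ)
    (hlam : 0 < lam) (hG : 0 < G) (ha : 0 < a) (hξ : 0 < ξ) (hν : 0 < ν)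
    (τ τ' f : ℝ → ℝ)
    (hτ : ∀ t ∈ Set.Ici (0 : ℝ), HasDerivWithinAt τ (τ' t) (Set.Ici 0) t)
    (heqτ : ∀ t ∈ Set.Ici (0 : ℝ), lam * τ' t = -f t * τ t + G * a)
    (hf : ∀ t ∈ Set.Ici (0 : ℝ),
      HasDerivWithinAt f ((-1 + ξ * |τ t|) * (f t) ^ 2 - ν * (f t) ^ 3)
        (Set.Ici 0) t)
    (hf0 : 0 < f 0) :
    ∃ M : ℝ, 0 ≤ M ∧ ∀ t ∈ Set.Ici (0 : ℝ), |τ t| + |f t| ≤ M := by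
  have hτc : ContinuousOn τ (Set.Ici 0) := fun t ht => (hτ t ht).continuousWithinAt
  have hfc : ContinuousOn f (Set.Ici 0) := fun t ht => (hf t ht).continuousWithinAt
  have fpos : ∀ t, 0 ≤ t → 0 < f t := by
    apply pos_aux f (fun t => (-1 + ξ * |τ t|) * f t - ν * (f t) ^ 2) (by fun_prop) _ hf0
    intro t ht
    convert hf t ht using 1
    ring
  have hb : 0 < G * a := mul_pos hG ha
  generalize G * a = b at heqτ hb
  have hm : ∀ t, 0 ≤ t → -τ t ≤ |τ 0| := by
    apply barrier_aux (fun t => -τ t) (fun t => -τ' t) _ (fun t ht => (hτ t ht).neg) (neg_le_abs _)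
    intro t ht h
    have h1 := abs_nonneg (τ 0)
    have h2 := heqτ t ht
    have h3 : 0 < f t * (-τ t) := mul_pos (fpos t ht) (by linarith)
    have : 0 < lam * τ' t := by linarith
    have := (pos_iff_pos_of_mul_pos this).1 hlam
    linarith
  have hlog : ∀ t ∈ Set.Ici (0 : ℝ), HasDerivWithinAt (fun t => -Real.log (f t))
      (f t * (1 - ξ * |τ t| + ν * f t)) (Set.Ici 0) t := by
    intro t ht
    have h1 := fpos t ht
    have h2 : f t * (1 - ξ * |τ t| + ν * f t) =
        -(((-1 + ξ * |τ t|) * (f t) ^ 2 - ν * (f t) ^ 3) / f t) := by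
      have h3 := h1.ne'
      rw [eq_neg_iff_add_eq_zero, add_comm, ← eq_neg_iff_add_eq_zero, div_eq_iff h3]
      ring
    rw [h2]
    exact ((hf t ht).log h1.ne').neg
  obtain ⟨φ, hφ0, hφ⟩ : ∃ φ : ℝ, 0 < φ ∧ ∀ x, 0 < x → x < φ → x + ν * x ^ 2 ≤ ξ * b := by
    refine ⟨min 1 (ξ * b / (1 + ν)), by positivity, fun x h0 h => ?_⟩
    have h1 := h.trans_le (min_le_left _ _)
    have h2 := h.trans_le (min_le_right _ _)
    rw [lt_div_iff₀ (by positivity)] at h2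
    have : ν * (x * x) ≤ ν * x := mul_le_mul_of_nonneg_left (by nlinarith) hν.le
    nlinarith
  obtain ⟨C, hC⟩ : ∃ C, ∀ t, 0 ≤ t → -Real.log (f t) - lam * ξ * τ t ≤ C := by
    refine ⟨max (-Real.log (f 0) - lam * ξ * τ 0) (-Real.log φ + lam * ξ * |τ 0|), ?_⟩
    apply barrier_aux (fun t => -Real.log (f t) - lam * ξ * τ t) _ _
      (fun t ht => (hlog t ht).sub ((hτ t ht).const_mul (lam * ξ))) (le_max_left _ _)
    intro t ht h
    have h1 := (le_max_right _ _).trans_lt h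
    have h2 := mul_le_mul_of_nonneg_left (hm t ht) (mul_pos hlam hξ).le
    have h3 : Real.log (f t) < Real.log φ := by linarith
    have h4 := (Real.log_lt_log_iff (fpos t ht) hφ0).1 h3
    have h5 := hφ _ (fpos t ht) h4
    have h6 : 0 ≤ f t * ξ * (|τ t| - τ t) :=
      mul_nonneg (mul_pos (fpos t ht) hξ).le (by linarith [le_abs_self (τ t)])
    have h7 : lam * ξ * τ' t = ξ * (-f t * τ t + b) := by rw [← heqτ t ht]; ring
    rw [h7]
    linarith
  obtain ⟨D, hD⟩ : ∃ D, ∀ t, 0 ≤ t → -Real.log (f t) ≤ D := by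
    refine ⟨max (-Real.log (f 0)) (max 0 (C + lam * (1 + ν))), ?_⟩
    apply barrier_aux (fun t => -Real.log (f t)) _ _ hlog (le_max_left _ _)
    intro t ht h
    have h1 := (le_max_right _ _).trans_lt h
    have h2 := (le_max_left _ _).trans_lt h1
    have h3 := (le_max_right _ _).trans_lt h1
    have h4 := hC t ht
    have h5 : f t < 1 := by
      rw [← Real.log_neg_iff (fpos t ht)]; linarith
    have h6 : lam * (1 + ν) < lam * (ξ * τ t) := by linarith
    have h7 := lt_of_mul_lt_mul_left h6 hlam.le
    have h8 := mul_le_mul_of_nonneg_left (le_abs_self (τ t)) hξ.le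
    have h9 := mul_lt_mul_of_pos_left h5 hν
    exact mul_nonpos_of_nonneg_of_nonpos (fpos t ht).le (by linarith)
  have hδ : ∀ t, 0 ≤ t → Real.exp (-D) ≤ f t := by
    intro t ht
    rw [← Real.le_log_iff_exp_le (fpos t ht)]
    linarith [hD t ht]
  have hδ0 := Real.exp_pos (-D)
  generalize Real.exp (-D) = δ at hδ hδ0
  obtain ⟨T, hT⟩ : ∃ T, ∀ t, 0 ≤ t → τ t ≤ T := by
    refine ⟨max (τ 0) (b / δ), ?_⟩
    apply barrier_aux τ τ' _ hτ (le_max_left _ _)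
    intro t ht h
    have h1 := (le_max_right _ _).trans_lt h
    have h0 : 0 < τ t := lt_trans (by positivity) h1
    rw [div_lt_iff₀ hδ0] at h1
    have h2 := mul_le_mul_of_nonneg_right (hδ t ht) h0.le
    have h3 := heqτ t ht
    have h4 : lam * τ' t ≤ 0 := by linarith
    by_contra h5
    push Not at h5
    linarith [mul_pos hlam h5]
  have hA : ∀ t, 0 ≤ t → |τ t| ≤ max T |τ 0| := fun t ht =>
    abs_le.2 ⟨by linarith [hm t ht, le_max_right T |τ 0|], (hT t ht).trans (le_max_left _ _)⟩
  generalize max T |τ 0| = A at hA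
  obtain ⟨F, hF⟩ : ∃ F, ∀ t, 0 ≤ t → f t ≤ F := by
    refine ⟨max (f 0) (ξ * A / ν), ?_⟩
    apply barrier_aux f _ _ hf (le_max_left _ _)
    intro t ht h
    have h1 := (le_max_right _ _).trans_lt h
    rw [div_lt_iff₀ hν] at h1
    have h2 := mul_le_mul_of_nonneg_left (hA t ht) hξ.le
    have h3 : (f t) ^ 2 * (-1 + ξ * |τ t| - ν * f t) ≤ 0 :=
      mul_nonpos_of_nonneg_of_nonpos (sq_nonneg _) (by linarith)
    linarith
  refine ⟨A + F, ?_, fun t ht => ?_⟩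
  · linarith [hA 0 le_rfl, hF 0 le_rfl, abs_nonneg (τ 0)]
  · rw [abs_of_pos (fpos t ht)]
    exact add_le_add (hA t ht) (hF t ht)
end
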